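/- Let H, K₁, K₂ be complex Hilbert spaces and let S : H → K₁, T : H → K₂, Q : K₂ → K₁ be bounded linear operators with S* ∘ Q ∘ T = Id_H. Then: (i) for every constant B > 0 with ‖Sf‖² ≤ B‖f‖² for all f ∈ H, one has ‖Tf‖² ≥ ‖f‖²/(B‖Q‖²) for all f ∈ H; and (ii) for every constant D > 0 with ‖Tf‖² ≤ D‖f‖² for all f ∈ H, one has ‖Sf‖² ≥ ‖f‖²/(D‖Q‖²) for all f ∈ H. Consequently, if S and T are the analysis operators of a CC'-controlled fusion frame W with optimal bounds A_op ≤ B_op and of its Q-dual W̃ with optimal bounds C_op ≤ D_op, then C_op ≥ B_op⁻¹‖Q‖⁻² and D_op ≥ A_op⁻¹‖Q‖⁻². -/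

import Mathlib

theorem aux_div (n q t s B : ℝ) (hn : 0 ≤ n) (hB : 0 < B)
    (h : n ^ 2 ≤ q * t * s) (hs : s ^ 2 ≤ B * n ^ 2) :
    n ^ 2 / (B * q ^ 2) ≤ t ^ 2 := by
  apply div_le_of_le_mul₀ (by positivity) (by positivity)
  rcases hn.eq_or_lt with h0 | h0
  · rw [← h0]
    have : 0 ≤ t ^ 2 * (B * q ^ 2) := by positivity
    simpa using this
  · have h1 : (n ^ 2) ^ 2 ≤ (q * t * s) ^ 2 := pow_le_pow_left₀ (by positivity) h 2
    have h2 : (q * t) ^ 2 * s ^ 2 ≤ (q * t) ^ 2 * (B * n ^ 2) :=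
      mul_le_mul_of_nonneg_left hs (by positivity)
    have h3 : 0 < n ^ 2 := by positivity
    refine le_of_mul_le_mul_right ?_ h3
    nlinarith

theorem stmt_9 {H K₁ K₂ : Type*}
    [NormedAddCommGroup H] [InnerProductSpace ℂ H] [CompleteSpace H]
    [NormedAddCommGroup K₁] [InnerProductSpace ℂ K₁] [CompleteSpace K₁]
    [NormedAddCommGroup K₂] [InnerProductSpace ℂ K₂] [CompleteSpace K₂]
    (S : H →L[ℂ] K₁) (T : H →L[ℂ] K₂) (Q : K₂ →L[ℂ] K₁)
    (hQ : (ContinuousLinearMap.adjoint S).comp (Q.comp T) = ContinuousLinearMap.id ℂ H) :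
    -- (i)
    (∀ B : ℝ, 0 < B → (∀ f : H, ‖S f‖ ^ 2 ≤ B * ‖f‖ ^ 2) →
      ∀ f : H, ‖f‖ ^ 2 / (B * ‖Q‖ ^ 2) ≤ ‖T f‖ ^ 2) ∧
    -- (ii)
    (∀ D : ℝ, 0 < D → (∀ f : H, ‖T f‖ ^ 2 ≤ D * ‖f‖ ^ 2) →
      ∀ f : H, ‖f‖ ^ 2 / (D * ‖Q‖ ^ 2) ≤ ‖S f‖ ^ 2) ∧
    -- consequently, for optimal frame bounds A_op ≤ B_op of W (with analysis operator S)
    -- and optimal bounds C_op ≤ D_op of its Q-dual W̃ (with analysis operator T):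
    (∀ Aop Bop Cop Dop : ℝ, 0 < Aop → Aop ≤ Bop → 0 < Cop → Cop ≤ Dop →
      (∀ f : H, Aop * ‖f‖ ^ 2 ≤ ‖S f‖ ^ 2) →
      (∀ f : H, ‖S f‖ ^ 2 ≤ Bop * ‖f‖ ^ 2) →
      (∀ A' : ℝ, (∀ f : H, A' * ‖f‖ ^ 2 ≤ ‖S f‖ ^ 2) → A' ≤ Aop) →
      (∀ B' : ℝ, (∀ f : H, ‖S f‖ ^ 2 ≤ B' * ‖f‖ ^ 2) → Bop ≤ B') →
      (∀ f : H, Cop * ‖f‖ ^ 2 ≤ ‖T f‖ ^ 2) →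
      (∀ f : H, ‖T f‖ ^ 2 ≤ Dop * ‖f‖ ^ 2) →
      (∀ C' : ℝ, (∀ f : H, C' * ‖f‖ ^ 2 ≤ ‖T f‖ ^ 2) → C' ≤ Cop) →
      (∀ D' : ℝ, (∀ f : H, ‖T f‖ ^ 2 ≤ D' * ‖f‖ ^ 2) → Dop ≤ D') →
      Bop⁻¹ * ‖Q‖⁻¹ ^ 2 ≤ Cop ∧ Aop⁻¹ * ‖Q‖⁻¹ ^ 2 ≤ Dop) := by
  have key : ∀ f : H, ‖f‖ ^ 2 ≤ ‖Q‖ * ‖T f‖ * ‖S f‖ := by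
    intro f
    have h1 : (ContinuousLinearMap.adjoint S) (Q (T f)) = f := by
      simpa using congrArg (fun L : H →L[ℂ] H => L f) hQ
    have h2 : inner ℂ (Q (T f)) (S f) = inner ℂ f f := by
      rw [← ContinuousLinearMap.adjoint_inner_left, h1]
    have h3 : ‖inner ℂ (Q (T f)) (S f)‖ ≤ ‖Q (T f)‖ * ‖S f‖ := norm_inner_le_norm _ _
    rw [h2, inner_self_eq_norm_sq_to_K] at h3
    have h4 : ‖f‖ ^ 2 ≤ ‖Q (T f)‖ * ‖S f‖ := by simpa using h3
    exact h4.trans (mul_le_mul_of_nonneg_right (Q.le_opNorm _) (norm_nonneg _))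
  have p1 : ∀ B : ℝ, 0 < B → (∀ f : H, ‖S f‖ ^ 2 ≤ B * ‖f‖ ^ 2) →
      ∀ f : H, ‖f‖ ^ 2 / (B * ‖Q‖ ^ 2) ≤ ‖T f‖ ^ 2 := fun B hB h f =>
    aux_div _ _ _ _ B (norm_nonneg f) hB (key f) (h f)
  have p2 : ∀ D : ℝ, 0 < D → (∀ f : H, ‖T f‖ ^ 2 ≤ D * ‖f‖ ^ 2) →
      ∀ f : H, ‖f‖ ^ 2 / (D * ‖Q‖ ^ 2) ≤ ‖S f‖ ^ 2 := fun D hD h f =>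
    aux_div _ _ _ _ D (norm_nonneg f) hD
      ((key f).trans_eq (mul_right_comm _ _ _)) (h f)
  refine ⟨p1, p2, ?_⟩
  intro A B C D hA hAB hC hCD _ hSB hAo _ _ hTD hCo _
  have hB : 0 < B := hA.trans_le hAB
  have hD : 0 < D := hC.trans_le hCD
  constructor
  · apply hCo
    intro f
    refine le_of_eq_of_le ?_ (p1 B hB hSB f)
    rw [div_eq_mul_inv, mul_inv, inv_pow, mul_comm]
  · have h : D⁻¹ * ‖Q‖⁻¹ ^ 2 ≤ A := by
      apply hAo
      intro f
      refine le_of_eq_of_le ?_ (p2 D hD hTD f)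
      rw [div_eq_mul_inv, mul_inv, inv_pow, mul_comm]
    rw [inv_mul_le_iff₀ hD] at h
    rw [inv_mul_le_iff₀ hA]
    linarith
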